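/- Let 0 < a < π√3/4, let Δ = Δ_hex(a), Λ = (2Δ) × 2πℤ, and let φ₀ : ℝ³ → ℝ³ be the screw motion φ₀(x,y,z) = (R_{π/3}(x,y), z + π/3), where R_θ is the rotation of ℝ² about the origin by angle θ (so φ₀³ = σ₀ where σ₀(x,y,z) = (−x,−y,z+π)). Then for every v ∈ Λ, every m ∈ ℝ³ and every piecewise C¹ curve γ: (i) if γ goes from m to φ₀(m) + v then L_Δ(γ) ≥ π/3 (and likewise for φ₀⁵); (ii) if γ goes from m to φ₀²(m) + v then L_Δ(γ) ≥ (2π/3)·cos(2a/√3) (and likewise for φ₀⁴). -/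

import Mathlib

open Real MeasureTheory Set

noncomputable section

/-- The point `(x, y)` of the Euclidean plane. -/
def pt2 (x y : ℝ) : EuclideanSpace ℝ (Fin 2) := (WithLp.equiv 2 (Fin 2 → ℝ)).symm ![x, y]

/-- `f : [0,1] → ℝ` is piecewise `C¹`. -/
def PC1 (f : ℝ → ℝ) : Prop :=
  ∃ (n : ℕ) (t : ℕ → ℝ), t 0 = 0 ∧ t n = 1 ∧ (∀ i < n, t i < t (i + 1)) ∧
    ContinuousOn f (Set.Icc 0 1) ∧ ∀ i < n, ContDiffOn ℝ 1 f (Set.Icc (t i) (t (i + 1)))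

/-- Length of `γ = (γ₁,γ₂,γ₃)` for the singular metric
`h = dx² + dy² + cos²(dist((x,y),Δ)) dz²`. -/
def sLen (Δ : Set (EuclideanSpace ℝ (Fin 2))) (γ₁ γ₂ γ₃ : ℝ → ℝ) : ℝ :=
  ∫ t in (0:ℝ)..1, Real.sqrt ((deriv γ₁ t) ^ 2 + (deriv γ₂ t) ^ 2 +
    Real.cos (Metric.infDist (pt2 (γ₁ t) (γ₂ t)) Δ) ^ 2 * (deriv γ₃ t) ^ 2)

/-- The hexagonal lattice `Δ_hex(a) = ℤ·(2a,0) + ℤ·(a, a√3) ⊂ ℝ²`. -/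
def ΔhexE (a : ℝ) : Set (EuclideanSpace ℝ (Fin 2)) :=
  {p | ∃ m n : ℤ, p = pt2 (2 * a * m + a * n) (a * Real.sqrt 3 * n)}

/-- The spatial lattice `Λ = (2Δ_hex(a)) × 2πℤ ⊂ ℝ³`. -/
def Λhex3 (a : ℝ) : Set (ℝ × ℝ × ℝ) :=
  {w | ∃ k₁ k₂ k₃ : ℤ, w = (4 * a * k₁ + 2 * a * k₂, 2 * a * Real.sqrt 3 * k₂, 2 * π * k₃)}

/-- The screw motion `φ₀(x,y,z) = (R_{π/3}(x,y), z + π/3)`, where `R_θ` is the rotation of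
`ℝ²` about the origin by the angle `θ`; one has `φ₀³ = σ₀`. -/
def phi0 (p : ℝ × ℝ × ℝ) : ℝ × ℝ × ℝ :=
  (Real.cos (π / 3) * p.1 - Real.sin (π / 3) * p.2.1,
   Real.sin (π / 3) * p.1 + Real.cos (π / 3) * p.2.1, p.2.2 + π / 3)

/-! ### Piecewise `C¹` functions -/

lemma exists_mem_Ioo_of_notMem_image {n : ℕ} {t : ℕ → ℝ} {x : ℝ} (hx : t 0 < x) (hx' : x < t n)
    (hxt : x ∉ t '' Set.Iic n) : ∃ i < n, x ∈ Set.Ioo (t i) (t (i + 1)) := by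
  induction n with
  | zero => exact absurd hx' hx.not_gt
  | succ k ih =>
    rcases lt_trichotomy x (t k) with h | h | h
    · obtain ⟨i, hi, hxi⟩ := ih h fun ⟨j, hj, hjx⟩ => hxt ⟨j, Nat.le_succ_of_le hj, hjx⟩
      exact ⟨i, hi.trans k.lt_succ_self, hxi⟩
    · exact absurd ⟨k, Nat.le_succ k, h.symm⟩ hxt
    · exact ⟨k, k.lt_succ_self, h, hx'⟩

lemma PC1.continuousOn {f : ℝ → ℝ} (hf : PC1 f) : ContinuousOn f (Set.Icc 0 1) := by
  obtain ⟨_, _, _, _, _, hc, _⟩ := hf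
  exact hc

lemma PC1.exists_bound {f : ℝ → ℝ} (hf : PC1 f) : ∃ (s : Set ℝ) (C : ℝ), s.Finite ∧
    ∀ x ∈ Set.Ioo 0 1 \ s, DifferentiableAt ℝ f x ∧ |deriv f x| ≤ C := by
  obtain ⟨n, t, h0, h1, hlt, -, hC⟩ := hf
  have hbound : ∀ i, ∃ B : ℝ, i < n → ∀ x ∈ Set.Icc (t i) (t (i + 1)),
      |derivWithin f (Set.Icc (t i) (t (i + 1))) x| ≤ B := by
    intro i
    by_cases hi : i < n
    · obtain ⟨B, hB⟩ := isCompact_Icc.exists_bound_of_continuousOn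
        ((hC i hi).continuousOn_derivWithin (uniqueDiffOn_Icc (hlt i hi)) le_rfl)
      exact ⟨B, fun _ => hB⟩
    · exact ⟨0, fun h => absurd h hi⟩
  choose B hB using hbound
  refine ⟨t '' Set.Iic n, ∑ i ∈ Finset.range n, |B i|, (Set.finite_Iic n).image t, ?_⟩
  rintro x ⟨⟨hx0, hx1⟩, hxt⟩
  obtain ⟨i, hi, hxi⟩ := exists_mem_Ioo_of_notMem_image (h0.trans_lt hx0) (hx1.trans_eq h1.symm) hxt
  have hnhds : Set.Icc (t i) (t (i + 1)) ∈ nhds x := Icc_mem_nhds hxi.1 hxi.2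
  refine ⟨((hC i hi).differentiableOn one_ne_zero).differentiableAt hnhds, ?_⟩
  rw [← derivWithin_of_mem_nhds hnhds]
  calc _ ≤ B i := hB i hi x (Set.Ioo_subset_Icc_self hxi)
    _ ≤ |B i| := le_abs_self _
    _ ≤ _ := Finset.single_le_sum (f := fun j => |B j|) (fun j _ => abs_nonneg _)
      (Finset.mem_range.2 hi)

/-! ### Displacement bounds -/

section Displacement

variable {E : Type*} [NormedAddCommGroup E] {σ : ℝ → ℝ} {s : Set ℝ}

/-- A curve whose speed is at most `σ` outside a countable set moves by at most `∫ σ`. -/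
lemma norm_sub_le_integral_of_norm_deriv_le [NormedSpace ℝ E] [CompleteSpace E] {F : ℝ → E}
    {a b : ℝ} (hab : a ≤ b) (hs : s.Countable) (hF : ContinuousOn F (Set.Icc a b))
    (hd : ∀ t ∈ Set.Ioo a b \ s, DifferentiableAt ℝ F t ∧ ‖deriv F t‖ ≤ σ t)
    (hσ : IntervalIntegrable σ volume a b) :
    ‖F b - F a‖ ≤ ∫ t in a..b, σ t := by
  have hae : ∀ᵐ t, t ∈ Set.Ioc a b → ‖deriv F t‖ ≤ σ t := by
    filter_upwards [(hs.insert b).ae_notMem volume] with t ht hab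
    rw [Set.mem_insert_iff, not_or] at ht
    exact (hd t ⟨⟨hab.1, lt_of_le_of_ne hab.2 ht.1⟩, ht.2⟩).2
  have hint : IntervalIntegrable (deriv F) volume a b := by
    refine hσ.mono_fun' (aestronglyMeasurable_deriv F _) ?_
    rw [Set.uIoc_of_le hab]
    exact (ae_restrict_iff' measurableSet_Ioc).2 hae
  rw [← integral_eq_of_hasDerivAt_off_countable F (deriv F) hs (by rwa [Set.uIcc_of_le hab])
    (fun t ht => (hd t (by rwa [min_eq_left hab, max_eq_right hab] at ht)).1.hasDerivAt) hint]
  exact intervalIntegral.norm_integral_le_of_norm_le hab hae hσ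

/-- A curve on the unit sphere of speed at most `σ` outside a countable set turns by an angle of at
most `∫ σ`. -/
lemma angle_le_integral_of_norm_deriv_le [InnerProductSpace ℝ E] {F : ℝ → E}
    {a b : ℝ} (hab : a ≤ b) (hs : s.Countable) (hF : ContinuousOn F (Set.Icc a b))
    (hF1 : ∀ t, ‖F t‖ = 1)
    (hd : ∀ t ∈ Set.Ioo a b \ s, DifferentiableAt ℝ F t ∧ ‖deriv F t‖ ≤ σ t)
    (hσ0 : ∀ t, 0 ≤ σ t) (hσ : IntervalIntegrable σ volume a b) :
    InnerProductGeometry.angle (F a) (F b) ≤ ∫ t in a..b, σ t := by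
  set u : ℝ → ℝ := fun t => inner ℝ (F a) (F t) with hu
  have huc : ContinuousOn u (Set.Icc a b) := continuousOn_const.inner hF
  have hle : ∀ t, u t ≤ 1 := fun t => by
    simpa [hF1] using real_inner_le_norm (F a) (F t)
  have hge : ∀ t, -1 ≤ u t := fun t => by
    simpa [hF1] using (abs_le.1 (abs_real_inner_le_norm (F a) (F t))).1
  have hua : u a = 1 := by simp [hu, hF1]
  have hangle : InnerProductGeometry.angle (F a) (F b) = Real.arccos (u b) := by
    simp [InnerProductGeometry.angle, hF1, hu]
  -- the last time at which `u = 1`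
  obtain ⟨p, ⟨hp, hup⟩, hpmax⟩ : ∃ p, IsGreatest {t ∈ Set.Icc a b | u t = 1} p := by
    refine IsCompact.exists_isGreatest ?_ ⟨a, Set.left_mem_Icc.2 hab, hua⟩
    exact isCompact_Icc.of_isClosed_subset
      (huc.preimage_isClosed_of_isClosed isClosed_Icc isClosed_singleton) Set.inter_subset_left
  have hpb : Set.Icc p b ⊆ Set.Icc a b := Set.Icc_subset_Icc_left hp.1
  -- the first later time at which `u ≤ u b`
  obtain ⟨q, ⟨hq, huq⟩, hqmin⟩ : ∃ q, IsLeast {t ∈ Set.Icc p b | u t ≤ u b} q := by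
    refine IsCompact.exists_isLeast ?_ ⟨b, Set.right_mem_Icc.2 hp.2, le_rfl⟩
    exact isCompact_Icc.of_isClosed_subset
      ((huc.mono hpb).preimage_isClosed_of_isClosed isClosed_Icc isClosed_Iic)
      Set.inter_subset_left
  have hpq : Set.Icc p q ⊆ Set.Icc a b := Set.Icc_subset_Icc hp.1 hq.2
  have hderiv : ∀ t ∈ Set.Ioo p q \ s, DifferentiableAt ℝ (fun t => Real.arccos (u t)) t ∧
      ‖deriv (fun t => Real.arccos (u t)) t‖ ≤ σ t := by
    rintro t ⟨ht, hts⟩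
    have ht' : t ∈ Set.Ioo a b := ⟨hp.1.trans_lt ht.1, ht.2.trans_le hq.2⟩
    have hut1 : u t ≠ 1 := fun h => ht.1.not_ge (hpmax ⟨Set.Ioo_subset_Icc_self ht', h⟩)
    have hutb : u b < u t := by
      by_contra! h
      exact ht.2.not_ge (hqmin ⟨⟨ht.1.le, ht'.2.le⟩, h⟩)
    have hut : u t ≠ -1 := ((hge b).trans_lt hutb).ne'
    obtain ⟨hFd, hFσ⟩ := hd t ⟨ht', hts⟩
    have hud : HasDerivAt u (inner ℝ (F a) (deriv F t)) t := by
      simpa using (hasDerivAt_const t (F a)).inner ℝ hFd.hasDerivAt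
    have horth : inner ℝ (F t) (deriv F t) = 0 := by
      have h1 := hFd.hasDerivAt.inner ℝ hFd.hasDerivAt
      have h2 : (fun t => inner ℝ (F t) (F t)) = fun _ => (1 : ℝ) := by
        ext t; simp [hF1]
      rw [h2] at h1
      have h3 := h1.unique (hasDerivAt_const t (1 : ℝ))
      rw [real_inner_comm (F t) (deriv F t)] at h3
      linarith
    have hh := (Real.hasDerivAt_arccos hut hut1).comp t hud
    have hpos : 0 < 1 - u t ^ 2 := by
      have h1 : u t < 1 := lt_of_le_of_ne (hle t) hut1
      have h2 : -1 < u t := (hge b).trans_lt hutb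
      nlinarith
    have hcs : |inner ℝ (F a) (deriv F t)| ≤ √(1 - u t ^ 2) * ‖deriv F t‖ := by
      have h1 : inner ℝ (F a - u t • F t) (deriv F t) = inner ℝ (F a) (deriv F t) := by
        rw [inner_sub_left, inner_smul_left, horth]; simp
      have h2 : ‖F a - u t • F t‖ = √(1 - u t ^ 2) := by
        rw [← Real.sqrt_sq (norm_nonneg _), norm_sub_sq_real, inner_smul_right, norm_smul, hF1, hF1]
        congr 1
        simp only [Real.norm_eq_abs, mul_one, sq_abs]
        simp only [hu]
        ring
      rw [← h1, ← h2]
      exact abs_real_inner_le_norm _ _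
    refine ⟨hh.differentiableAt, ?_⟩
    rw [show deriv (fun t => Real.arccos (u t)) t = _ from hh.deriv, Real.norm_eq_abs, abs_mul,
      abs_neg, abs_of_pos (by positivity : 0 < 1 / √(1 - u t ^ 2)), one_div, inv_mul_le_iff₀
      (Real.sqrt_pos.2 hpos)]
    exact hcs.trans (by gcongr)
  have hmono : IntervalIntegrable σ volume p q :=
    hσ.mono_set (by rwa [Set.uIcc_of_le hab, Set.uIcc_of_le hq.1])
  have hmain := norm_sub_le_integral_of_norm_deriv_le hq.1 hs
    (Real.continuous_arccos.comp_continuousOn (huc.mono hpq)) hderiv hmono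
  have : Real.arccos (u b) ≤ ∫ t in p..q, σ t := by
    refine le_trans (Real.antitone_arccos huq) ((le_abs_self _).trans ?_)
    simpa [hup] using hmain
  rw [hangle]
  exact this.trans (intervalIntegral.integral_mono_interval hp.1 hq.1 hq.2
    (Filter.Eventually.of_forall hσ0) hσ)

end Displacement

/-! ### The round metric around a lattice axis -/

/-- The map `(r cos θ, r sin θ, z) ↦ (sin r · e^{iθ}, cos r · e^{iz})` to the unit sphere of
`ℂ² = ℝ⁴`, written in Cartesian coordinates. -/
def toSphere (x y z : ℝ) : EuclideanSpace ℝ (Fin 4) :=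
  !₂[Real.sinc √(x ^ 2 + y ^ 2) * x, Real.sinc √(x ^ 2 + y ^ 2) * y,
    Real.cos √(x ^ 2 + y ^ 2) * Real.cos z, Real.cos √(x ^ 2 + y ^ 2) * Real.sin z]

lemma sinc_mul_self (x : ℝ) : Real.sinc x * x = Real.sin x := by
  rcases eq_or_ne x 0 with rfl | hx
  · simp
  · rw [Real.sinc_of_ne_zero hx, div_mul_cancel₀ _ hx]

lemma sinc_sq_mul (x y : ℝ) :
    Real.sinc √(x ^ 2 + y ^ 2) ^ 2 * (x ^ 2 + y ^ 2) = Real.sin √(x ^ 2 + y ^ 2) ^ 2 := by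
  rw [← sinc_mul_self, mul_pow, Real.sq_sqrt (by positivity)]

lemma norm_toSphere (x y z : ℝ) : ‖toSphere x y z‖ = 1 := by
  rw [← sq_eq_sq₀ (norm_nonneg _) zero_le_one, EuclideanSpace.norm_sq_eq]
  simp only [toSphere, Fin.sum_univ_four, Real.norm_eq_abs, sq_abs]
  simp only [Matrix.cons_val]
  linear_combination sinc_sq_mul x y + Real.sin_sq_add_cos_sq √(x ^ 2 + y ^ 2) +
    Real.cos √(x ^ 2 + y ^ 2) ^ 2 * Real.sin_sq_add_cos_sq z

lemma continuous_toSphere : Continuous fun p : ℝ × ℝ × ℝ => toSphere p.1 p.2.1 p.2.2 := by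
  unfold toSphere
  refine (PiLp.continuous_toLp 2 _).comp (continuous_pi fun i => ?_)
  have h := Real.continuous_sinc
  fin_cases i <;> simp <;> fun_prop

/-- Rotating by `π / 3` around the axis while the height changes by `c` with `cos c = 1 / 2` turns
the image on the sphere by the angle `π / 3`. -/
lemma angle_toSphere {x y z x' y' z' : ℝ} (hr : x' ^ 2 + y' ^ 2 = x ^ 2 + y ^ 2)
    (hi : x * x' + y * y' = (x ^ 2 + y ^ 2) / 2) (hz : Real.cos (z' - z) = 1 / 2) :
    InnerProductGeometry.angle (toSphere x y z) (toSphere x' y' z') = π / 3 := by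
  have : inner ℝ (toSphere x y z) (toSphere x' y' z') = 1 / 2 := by
    rw [Real.cos_sub] at hz
    rw [PiLp.inner_apply]
    simp only [toSphere, Fin.sum_univ_four, hr, Matrix.cons_val]
    simp only [RCLike.inner_apply, conj_trivial]
    linear_combination Real.sinc √(x ^ 2 + y ^ 2) ^ 2 * hi + sinc_sq_mul x y / 2 +
      Real.sin_sq_add_cos_sq √(x ^ 2 + y ^ 2) / 2 + Real.cos √(x ^ 2 + y ^ 2) ^ 2 * hz
  rw [InnerProductGeometry.angle, norm_toSphere, norm_toSphere, this,
    ← Real.cos_pi_div_three, mul_one, div_one, Real.arccos_cos (by positivity)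
    (by linarith [Real.pi_pos])]

lemma hasDerivAt_mul_of_eq_zero {g f : ℝ → ℝ} {f' t : ℝ} (hg : ContinuousAt g t)
    (hf : HasDerivAt f f' t) (h0 : f t = 0) : HasDerivAt (fun s => g s * f s) (g t * f') t := by
  rw [hasDerivAt_iff_tendsto_slope] at hf ⊢
  refine ((hg.tendsto.mono_left nhdsWithin_le_nhds).mul hf).congr fun s => ?_
  simp only [slope_def_field, h0]
  ring

lemma cos_eq_one_add (r : ℝ) : Real.cos r = 1 + -(1 / 2) * Real.sinc (r / 2) ^ 2 * r ^ 2 := by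
  have h := sinc_mul_self (r / 2)
  have h2 : Real.cos r = 2 * Real.cos (r / 2) ^ 2 - 1 := by
    rw [← Real.cos_two_mul, mul_div_cancel₀ _ two_ne_zero]
  have h3 := Real.sin_sq_add_cos_sq (r / 2)
  rw [← h] at h3
  linear_combination h2 + 2 * h3

section Derivative

variable {x y z : ℝ → ℝ} {x' y' z' t : ℝ}

lemma hasDerivAt_toLp_four {f₀ f₁ f₂ f₃ : ℝ → ℝ} {d₀ d₁ d₂ d₃ : ℝ} (h₀ : HasDerivAt f₀ d₀ t)
    (h₁ : HasDerivAt f₁ d₁ t) (h₂ : HasDerivAt f₂ d₂ t) (h₃ : HasDerivAt f₃ d₃ t) :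
    HasDerivAt (fun s => (!₂[f₀ s, f₁ s, f₂ s, f₃ s] : EuclideanSpace ℝ (Fin 4)))
      !₂[d₀, d₁, d₂, d₃] t := by
  have h : HasDerivAt (fun s => ![f₀ s, f₁ s, f₂ s, f₃ s]) ![d₀, d₁, d₂, d₃] t := by
    rw [hasDerivAt_pi]
    intro i
    fin_cases i <;> assumption
  exact ((PiLp.continuousLinearEquiv 2 ℝ (fun _ : Fin 4 => ℝ)).symm.hasFDerivAt.comp_hasDerivAt t h)

/-- `toSphere` does not increase lengths. -/
lemma exists_hasDerivAt_toSphere (hx : HasDerivAt x x' t) (hy : HasDerivAt y y' t)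
    (hz : HasDerivAt z z' t) :
    ∃ F', HasDerivAt (fun s => toSphere (x s) (y s) (z s)) F' t ∧
      ‖F'‖ ^ 2 ≤ x' ^ 2 + y' ^ 2 + Real.cos √(x t ^ 2 + y t ^ 2) ^ 2 * z' ^ 2 := by
  have hsq : HasDerivAt (fun s => x s ^ 2 + y s ^ 2) (2 * x t * x' + 2 * y t * y') t := by
    refine ((hx.pow 2).add (hy.pow 2)).congr_deriv ?_
    simp
  have hcz := hz.cos
  have hsz := hz.sin
  have htrig := Real.sin_sq_add_cos_sq (z t)
  rcases eq_or_ne (x t ^ 2 + y t ^ 2) 0 with h0 | h0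
  · have hx0 : x t = 0 := by nlinarith [sq_nonneg (x t), sq_nonneg (y t)]
    have hy0 : y t = 0 := by nlinarith [sq_nonneg (x t), sq_nonneg (y t)]
    have hr : ContinuousAt (fun s => √(x s ^ 2 + y s ^ 2)) t := hsq.continuousAt.sqrt
    have hq : ContinuousAt (fun s => Real.sinc √(x s ^ 2 + y s ^ 2)) t :=
      Real.continuous_sinc.continuousAt.comp hr
    have hq2 : ContinuousAt (fun s => -(1 / 2) * Real.sinc (√(x s ^ 2 + y s ^ 2) / 2) ^ 2) t :=
      continuousAt_const.mul ((Real.continuous_sinc.continuousAt.comp (hr.div_const 2)).pow 2)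
    have hc : HasDerivAt (fun s => Real.cos √(x s ^ 2 + y s ^ 2)) 0 t := by
      have h1 := (hasDerivAt_mul_of_eq_zero hq2 hsq h0).const_add 1
      have h2 : (fun s => Real.cos √(x s ^ 2 + y s ^ 2)) = fun s =>
          1 + -(1 / 2) * Real.sinc (√(x s ^ 2 + y s ^ 2) / 2) ^ 2 * (x s ^ 2 + y s ^ 2) := by
        ext s
        rw [cos_eq_one_add, Real.sq_sqrt (by positivity)]
      rw [h2]
      simpa [hx0, hy0] using h1
    refine ⟨_, hasDerivAt_toLp_four (hasDerivAt_mul_of_eq_zero hq hx hx0)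
      (hasDerivAt_mul_of_eq_zero hq hy hy0) (hc.mul hcz) (hc.mul hsz), ?_⟩
    rw [EuclideanSpace.norm_sq_eq]
    simp only [Fin.sum_univ_four, Real.norm_eq_abs, sq_abs, Matrix.cons_val]
    simp only [h0, Real.sqrt_zero, Real.sinc_zero, Real.cos_zero]
    refine le_of_eq ?_
    linear_combination z' ^ 2 * htrig
  · have hpos : 0 < x t ^ 2 + y t ^ 2 := lt_of_le_of_ne (by positivity) h0.symm
    have hr := hsq.sqrt h0
    set r : ℝ → ℝ := fun s => √(x s ^ 2 + y s ^ 2)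
    have hr0 : 0 < r t := Real.sqrt_pos.2 hpos
    have hrsq : r t ^ 2 = x t ^ 2 + y t ^ 2 := Real.sq_sqrt hpos.le
    set r' := (2 * x t * x' + 2 * y t * y') / (2 * √(x t ^ 2 + y t ^ 2)) with hr'def
    have hrr' : r t * r' = x t * x' + y t * y' := by
      have : √(x t ^ 2 + y t ^ 2) = r t := rfl
      rw [hr'def, this]
      field_simp
    have hq : HasDerivAt (fun s => Real.sinc (r s))
        ((Real.cos (r t) - Real.sinc (r t)) * r' / r t) t := by
      have h1 : HasDerivAt (fun s => Real.sin (r s) / r s) _ t := hr.sin.div hr hr0.ne'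
      have h2 : (fun s => Real.sinc (r s)) =ᶠ[nhds t] fun s => Real.sin (r s) / r s := by
        filter_upwards [hr.continuousAt.eventually_ne hr0.ne'] with s hs
        exact Real.sinc_of_ne_zero hs
      refine (h1.congr_of_eventuallyEq h2).congr_deriv ?_
      rw [Real.sinc_of_ne_zero hr0.ne']
      field_simp
    have hc := hr.cos
    refine ⟨_, hasDerivAt_toLp_four (hq.mul hx) (hq.mul hy) (hc.mul hcz) (hc.mul hsz), ?_⟩
    rw [EuclideanSpace.norm_sq_eq]
    simp only [Fin.sum_univ_four, Real.norm_eq_abs, sq_abs, Matrix.cons_val]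
    have hsinc := sinc_mul_self (r t)
    have htr := Real.sin_sq_add_cos_sq (r t)
    have hq1 : Real.sinc (r t) ^ 2 ≤ 1 := by
      rw [sq_le_one_iff_abs_le_one]; exact Real.abs_sinc_le_one _
    have hr'le : r' ^ 2 ≤ x' ^ 2 + y' ^ 2 := by
      refine le_of_mul_le_mul_left ?_ (pow_pos hr0 2)
      rw [← mul_pow, hrr', hrsq]
      nlinarith [sq_nonneg (x t * y' - y t * x')]
    have hdiv : r' / r t * r t = r' := div_mul_cancel₀ _ hr0.ne'
    generalize Real.sinc (r t) = q at *
    generalize hk : r' / r t = k at *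
    have hxy : k * r t ^ 2 = x t * x' + y t * y' := by rw [← hrr', ← hdiv]; ring
    have key : r' ^ 2 * (1 - q ^ 2) + q ^ 2 * (x' ^ 2 + y' ^ 2) ≤ x' ^ 2 + y' ^ 2 := by
      nlinarith [mul_le_mul_of_nonneg_right hr'le (sub_nonneg.2 hq1)]
    have hform : (Real.cos (r t) - q) * r' / r t = (Real.cos (r t) - q) * k := by
      rw [← hk]; ring
    rw [hform]
    rw [← hsinc] at htr ⊢
    rw [← hdiv] at key ⊢
    generalize Real.cos (r t) = c at *
    refine le_trans (le_of_eq ?_) (add_le_add_left key _)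
    linear_combination (q ^ 2 * k ^ 2 * r t ^ 4 + c ^ 2 * z' ^ 2) * htrig + k ^ 2 * r t ^ 2 * htr -
      (c - q) ^ 2 * k ^ 2 * hrsq - 2 * q * (c - q) * k * hxy

end Derivative

/-! ### Lengths of piecewise `C¹` curves -/

lemma dist_pt2 (x y x' y' : ℝ) : dist (pt2 x y) (pt2 x' y') = √((x - x') ^ 2 + (y - y') ^ 2) := by
  simp [pt2, EuclideanSpace.dist_eq, Real.dist_eq]

lemma continuous_pt2 : Continuous fun p : ℝ × ℝ => pt2 p.1 p.2 := by
  unfold pt2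
  refine (PiLp.continuous_toLp 2 _).comp (continuous_pi fun i => ?_)
  fin_cases i <;> simp <;> fun_prop

section Curve

variable {Δ : Set (EuclideanSpace ℝ (Fin 2))} {γ₁ γ₂ γ₃ : ℝ → ℝ}

/-- The speed of a curve for the singular metric. -/
def speed (Δ : Set (EuclideanSpace ℝ (Fin 2))) (γ₁ γ₂ γ₃ : ℝ → ℝ) (t : ℝ) : ℝ :=
  √(deriv γ₁ t ^ 2 + deriv γ₂ t ^ 2 +
    Real.cos (Metric.infDist (pt2 (γ₁ t) (γ₂ t)) Δ) ^ 2 * deriv γ₃ t ^ 2)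

lemma speed_nonneg (t : ℝ) : 0 ≤ speed Δ γ₁ γ₂ γ₃ t := Real.sqrt_nonneg _

lemma exists_finite_differentiableAt (h₁ : PC1 γ₁) (h₂ : PC1 γ₂) (h₃ : PC1 γ₃) :
    ∃ s : Set ℝ, s.Finite ∧ ∀ t ∈ Set.Ioo 0 1 \ s,
      DifferentiableAt ℝ γ₁ t ∧ DifferentiableAt ℝ γ₂ t ∧ DifferentiableAt ℝ γ₃ t := by
  obtain ⟨s₁, _, hs₁, hd₁⟩ := h₁.exists_bound
  obtain ⟨s₂, _, hs₂, hd₂⟩ := h₂.exists_bound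
  obtain ⟨s₃, _, hs₃, hd₃⟩ := h₃.exists_bound
  refine ⟨s₁ ∪ s₂ ∪ s₃, (hs₁.union hs₂).union hs₃, fun t ⟨ht, hts⟩ => ?_⟩
  simp only [Set.mem_union, not_or] at hts
  exact ⟨(hd₁ t ⟨ht, hts.1.1⟩).1, (hd₂ t ⟨ht, hts.1.2⟩).1, (hd₃ t ⟨ht, hts.2⟩).1⟩

lemma sLen_eq_integral_speed :
    sLen Δ γ₁ γ₂ γ₃ = ∫ t in (0 : ℝ)..1, speed Δ γ₁ γ₂ γ₃ t := rfl

lemma aestronglyMeasurable_sqrt_sq_add {μ : Measure ℝ} {f g h c : ℝ → ℝ}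
    (hf : AEStronglyMeasurable f μ) (hg : AEStronglyMeasurable g μ)
    (hh : AEStronglyMeasurable h μ) (hc : AEStronglyMeasurable c μ) :
    AEStronglyMeasurable (fun t => √(f t ^ 2 + g t ^ 2 + c t ^ 2 * h t ^ 2)) μ :=
  Real.continuous_sqrt.comp_aestronglyMeasurable
    (((hf.pow 2).add (hg.pow 2)).add ((hc.pow 2).mul (hh.pow 2)))

lemma intervalIntegrable_speed (h₁ : PC1 γ₁) (h₂ : PC1 γ₂) (h₃ : PC1 γ₃) :
    IntervalIntegrable (speed Δ γ₁ γ₂ γ₃) volume 0 1 := by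
  obtain ⟨s₁, C₁, hs₁, hd₁⟩ := h₁.exists_bound
  obtain ⟨s₂, C₂, hs₂, hd₂⟩ := h₂.exists_bound
  obtain ⟨s₃, C₃, hs₃, hd₃⟩ := h₃.exists_bound
  refine (intervalIntegrable_const (c := √(C₁ ^ 2 + C₂ ^ 2 + C₃ ^ 2))).mono_fun' ?_ ?_
  · have hcos : AEStronglyMeasurable
        (fun t => Real.cos (Metric.infDist (pt2 (γ₁ t) (γ₂ t)) Δ))
        (volume.restrict (Set.Ioc 0 1)) := by
      have hc : Continuous fun p : ℝ × ℝ => Real.cos (Metric.infDist (pt2 p.1 p.2) Δ) :=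
        Real.continuous_cos.comp ((Metric.continuous_infDist_pt Δ).comp continuous_pt2)
      have hγ : ContinuousOn (fun t => (γ₁ t, γ₂ t)) (Set.Ioc 0 1) :=
        (h₁.continuousOn.prodMk h₂.continuousOn).mono Set.Ioc_subset_Icc_self
      exact (hc.comp_continuousOn hγ).aestronglyMeasurable measurableSet_Ioc
    rw [Set.uIoc_of_le zero_le_one]
    exact aestronglyMeasurable_sqrt_sq_add (aestronglyMeasurable_deriv γ₁ _)
      (aestronglyMeasurable_deriv γ₂ _) (aestronglyMeasurable_deriv γ₃ _) hcos
  · rw [Set.uIoc_of_le zero_le_one]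
    refine (ae_restrict_iff' measurableSet_Ioc).2 ?_
    filter_upwards [(((hs₁.union hs₂).union hs₃).insert 1).countable.ae_notMem volume] with t ht ht01
    simp only [Set.mem_insert_iff, Set.mem_union, not_or] at ht
    have ht' : t ∈ Set.Ioo 0 1 := ⟨ht01.1, lt_of_le_of_ne ht01.2 ht.1⟩
    rw [Real.norm_of_nonneg (speed_nonneg t)]
    refine Real.sqrt_le_sqrt ?_
    have b₁ := sq_le_sq.2 ((hd₁ t ⟨ht', ht.2.1.1⟩).2.trans (le_abs_self _))
    have b₂ := sq_le_sq.2 ((hd₂ t ⟨ht', ht.2.1.2⟩).2.trans (le_abs_self _))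
    have b₃ := sq_le_sq.2 ((hd₃ t ⟨ht', ht.2.2⟩).2.trans (le_abs_self _))
    have b₄ := Real.cos_sq_le_one (Metric.infDist (pt2 (γ₁ t) (γ₂ t)) Δ)
    nlinarith [mul_le_mul_of_nonneg_right b₄ (sq_nonneg (deriv γ₃ t))]

/-- The length of a curve bounds the Euclidean displacement of its planar part. -/
lemma dist_le_integral_speed (h₁ : PC1 γ₁) (h₂ : PC1 γ₂) (h₃ : PC1 γ₃) {a b : ℝ} (ha : 0 ≤ a)
    (hab : a ≤ b) (hb : b ≤ 1) :
    dist (pt2 (γ₁ a) (γ₂ a)) (pt2 (γ₁ b) (γ₂ b)) ≤ ∫ t in a..b, speed Δ γ₁ γ₂ γ₃ t := by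
  obtain ⟨s, hs, hd⟩ := exists_finite_differentiableAt h₁ h₂ h₃
  rw [dist_comm, dist_eq_norm]
  have hsub : Set.Icc a b ⊆ Set.Icc 0 1 := Set.Icc_subset_Icc ha hb
  refine norm_sub_le_integral_of_norm_deriv_le (F := fun t => pt2 (γ₁ t) (γ₂ t)) hab hs.countable
    (continuous_pt2.comp_continuousOn ((h₁.continuousOn.prodMk h₂.continuousOn).mono hsub)) ?_
    ((intervalIntegrable_speed h₁ h₂ h₃).mono_set
      (by rwa [Set.uIcc_of_le hab, Set.uIcc_of_le zero_le_one]))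
  rintro t ⟨ht, hts⟩
  obtain ⟨hd₁, hd₂, -⟩ := hd t ⟨Set.Ioo_subset_Ioo ha hb ht, hts⟩
  have hP : HasDerivAt (fun t => pt2 (γ₁ t) (γ₂ t)) (pt2 (deriv γ₁ t) (deriv γ₂ t)) t := by
    have h : HasDerivAt (fun s => ![γ₁ s, γ₂ s]) ![deriv γ₁ t, deriv γ₂ t] t := by
      rw [hasDerivAt_pi]
      intro i
      fin_cases i
      exacts [hd₁.hasDerivAt, hd₂.hasDerivAt]
    exact (PiLp.continuousLinearEquiv 2 ℝ (fun _ : Fin 2 => ℝ)).symm.hasFDerivAt.comp_hasDerivAt t h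
  refine ⟨hP.differentiableAt, ?_⟩
  rw [hP.deriv, EuclideanSpace.norm_eq]
  refine Real.sqrt_le_sqrt ?_
  simp only [Fin.sum_univ_two, Real.norm_eq_abs, sq_abs]
  simp only [pt2, WithLp.equiv_symm_apply, Matrix.cons_val]
  exact le_add_of_nonneg_right (by positivity)

/-- The length of a curve bounds its vertical displacement, up to the factor `c` by which the metric
shrinks vertical lengths. -/
lemma mul_abs_sub_le_sLen (h₁ : PC1 γ₁) (h₂ : PC1 γ₂) (h₃ : PC1 γ₃) {c : ℝ} (hc : 0 ≤ c)
    (hcos : ∀ p, c ≤ Real.cos (Metric.infDist p Δ)) :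
    c * |γ₃ 1 - γ₃ 0| ≤ sLen Δ γ₁ γ₂ γ₃ := by
  obtain ⟨s, hs, hd⟩ := exists_finite_differentiableAt h₁ h₂ h₃
  have h := norm_sub_le_integral_of_norm_deriv_le (F := fun t => c * γ₃ t) zero_le_one hs.countable
    (continuousOn_const.mul h₃.continuousOn) (σ := speed Δ γ₁ γ₂ γ₃) (fun t ht => ?_)
    (intervalIntegrable_speed h₁ h₂ h₃)
  · rwa [← mul_sub, norm_mul, Real.norm_of_nonneg hc, Real.norm_eq_abs] at h
  · obtain ⟨-, -, hd₃⟩ := hd t ht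
    have h3 := hd₃.hasDerivAt.const_mul c
    refine ⟨h3.differentiableAt, ?_⟩
    rw [h3.deriv, Real.norm_eq_abs]
    refine Real.abs_le_sqrt ?_
    rw [mul_pow]
    have h4 := pow_le_pow_left₀ hc (hcos (pt2 (γ₁ t) (γ₂ t))) 2
    nlinarith [mul_le_mul_of_nonneg_right h4 (sq_nonneg (deriv γ₃ t)), sq_nonneg (deriv γ₁ t),
      sq_nonneg (deriv γ₂ t)]

/-- A curve staying within distance `π / 2` of a point of `Δ` is at least as long as the angle
between the images of its endpoints in the round sphere. -/
lemma angle_toSphere_le_sLen {d₁ d₂ : ℝ} (hdΔ : pt2 d₁ d₂ ∈ Δ) (h₁ : PC1 γ₁) (h₂ : PC1 γ₂)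
    (h₃ : PC1 γ₃)
    (hnear : ∀ t ∈ Set.Icc (0 : ℝ) 1, dist (pt2 (γ₁ t) (γ₂ t)) (pt2 d₁ d₂) ≤ π / 2) :
    InnerProductGeometry.angle (toSphere (γ₁ 0 - d₁) (γ₂ 0 - d₂) (γ₃ 0))
      (toSphere (γ₁ 1 - d₁) (γ₂ 1 - d₂) (γ₃ 1)) ≤ sLen Δ γ₁ γ₂ γ₃ := by
  obtain ⟨s, hs, hd⟩ := exists_finite_differentiableAt h₁ h₂ h₃
  have hγ : ContinuousOn (fun t => (γ₁ t - d₁, γ₂ t - d₂, γ₃ t)) (Set.Icc 0 1) :=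
    (h₁.continuousOn.sub continuousOn_const).prodMk
      ((h₂.continuousOn.sub continuousOn_const).prodMk h₃.continuousOn)
  have hcont := continuous_toSphere.comp_continuousOn hγ
  rw [sLen_eq_integral_speed]
  refine angle_le_integral_of_norm_deriv_le (σ := speed Δ γ₁ γ₂ γ₃)
    (F := fun t => toSphere (γ₁ t - d₁) (γ₂ t - d₂) (γ₃ t)) zero_le_one hs.countable hcont
    (fun t => norm_toSphere _ _ _) (fun t ht => ?_) speed_nonneg
    (intervalIntegrable_speed h₁ h₂ h₃)
  obtain ⟨hd₁, hd₂, hd₃⟩ := hd t ht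
  obtain ⟨F', hF', hle⟩ := exists_hasDerivAt_toSphere (hd₁.hasDerivAt.sub_const d₁)
    (hd₂.hasDerivAt.sub_const d₂) hd₃.hasDerivAt
  refine ⟨hF'.differentiableAt, ?_⟩
  rw [hF'.deriv]
  refine Real.le_sqrt_of_sq_le (hle.trans ?_)
  have hr := hnear t (Set.Ioo_subset_Icc_self ht.1)
  have hinf := Metric.infDist_le_dist_of_mem (x := pt2 (γ₁ t) (γ₂ t)) hdΔ
  have hinf0 := Metric.infDist_nonneg (x := pt2 (γ₁ t) (γ₂ t)) (s := Δ)
  rw [dist_pt2] at hr hinf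
  have hc0 : 0 ≤ Real.cos √((γ₁ t - d₁) ^ 2 + (γ₂ t - d₂) ^ 2) :=
    Real.cos_nonneg_of_neg_pi_div_two_le_of_le
      ((neg_nonpos.2 (by positivity)).trans (Real.sqrt_nonneg _)) hr
  have hcos := Real.cos_le_cos_of_nonneg_of_le_pi hinf0 (by linarith [Real.pi_pos]) hinf
  gcongr

/-- A screw motion of angle `π / 3` around the axis over a point of `Δ`, whose translation part `c`
satisfies `cos c = 1 / 2`, moves every point by at least `π / 3`. -/
lemma pi_div_three_le_sLen {d₁ d₂ : ℝ} (hdΔ : pt2 d₁ d₂ ∈ Δ) (h₁ : PC1 γ₁) (h₂ : PC1 γ₂)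
    (h₃ : PC1 γ₃)
    (hr : (γ₁ 1 - d₁) ^ 2 + (γ₂ 1 - d₂) ^ 2 = (γ₁ 0 - d₁) ^ 2 + (γ₂ 0 - d₂) ^ 2)
    (hi : (γ₁ 0 - d₁) * (γ₁ 1 - d₁) + (γ₂ 0 - d₂) * (γ₂ 1 - d₂) =
      ((γ₁ 0 - d₁) ^ 2 + (γ₂ 0 - d₂) ^ 2) / 2)
    (hz : Real.cos (γ₃ 1 - γ₃ 0) = 1 / 2) :
    π / 3 ≤ sLen Δ γ₁ γ₂ γ₃ := by
  by_cases hnear : ∀ t ∈ Set.Icc (0 : ℝ) 1, dist (pt2 (γ₁ t) (γ₂ t)) (pt2 d₁ d₂) ≤ π / 2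
  · exact (angle_toSphere hr hi hz).symm.le.trans (angle_toSphere_le_sLen hdΔ h₁ h₂ h₃ hnear)
  · push Not at hnear
    obtain ⟨t, ht, hfar⟩ := hnear
    have hint := intervalIntegrable_speed (Δ := Δ) h₁ h₂ h₃
    have hsum : sLen Δ γ₁ γ₂ γ₃ =
        (∫ t in (0 : ℝ)..t, speed Δ γ₁ γ₂ γ₃ t) + ∫ t in t..1, speed Δ γ₁ γ₂ γ₃ t := by
      rw [intervalIntegral.integral_add_adjacent_intervals]
      · rfl
      · exact hint.mono_set (Set.uIcc_subset_uIcc_left (by rwa [Set.uIcc_of_le zero_le_one]))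
      · exact hint.mono_set (Set.uIcc_subset_uIcc_right (by rwa [Set.uIcc_of_le zero_le_one]))
    have hA := dist_le_integral_speed (Δ := Δ) h₁ h₂ h₃ le_rfl ht.1 ht.2
    have hB := dist_le_integral_speed (Δ := Δ) h₁ h₂ h₃ ht.1 ht.2 le_rfl
    set A := pt2 (γ₁ 0) (γ₂ 0)
    set B := pt2 (γ₁ 1) (γ₂ 1)
    set q := pt2 (γ₁ t) (γ₂ t)
    set d := pt2 d₁ d₂
    have hBd : dist B d = dist A d := by rw [dist_pt2, dist_pt2, hr]
    have hAB : dist A B = dist A d := by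
      rw [dist_pt2, dist_pt2]
      congr 1
      linear_combination hr - 2 * hi
    have t1 := dist_triangle A q B
    have t2 := dist_triangle q A d
    have t3 := dist_triangle q B d
    rw [dist_comm q A] at t2
    linarith

end Curve

/-! ### The hexagonal lattice -/

/-- The covering radius of the hexagonal lattice is at most `2a / √3`. -/
lemma infDist_ΔhexE_le {a : ℝ} (ha : 0 < a) (p : EuclideanSpace ℝ (Fin 2)) :
    Metric.infDist p (ΔhexE a) ≤ 2 * a / √3 := by
  have hs3 : √3 ^ 2 = 3 := Real.sq_sqrt (by norm_num)
  obtain ⟨x, y, rfl⟩ : ∃ x y, p = pt2 x y := by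
    refine ⟨p 0, p 1, ?_⟩
    ext i; fin_cases i <;> simp [pt2]
  suffices h : ∃ m n : ℤ, (x - (2 * a * m + a * n)) ^ 2 + (y - a * √3 * n) ^ 2 ≤ (2 * a / √3) ^ 2 by
    obtain ⟨m, n, h⟩ := h
    refine (Metric.infDist_le_dist_of_mem (s := ΔhexE a) (y := pt2 (2 * a * m + a * n) (a * √3 * n))
      ⟨m, n, rfl⟩).trans ?_
    rw [dist_pt2]
    exact (Real.sqrt_le_left (by positivity)).2 h
  obtain ⟨n, η, hη0, hη1, hy⟩ : ∃ (n : ℤ) (η : ℝ), 0 ≤ η ∧ η ≤ 1 ∧ y = a * √3 * (n + η) :=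
    ⟨⌊y / (a * √3)⌋, Int.fract (y / (a * √3)), Int.fract_nonneg _, (Int.fract_lt_one _).le, by
      rw [Int.floor_add_fract]; field_simp⟩
  obtain ⟨m, ξ, hξ0, hξ1, hx⟩ : ∃ (m : ℤ) (ξ : ℝ), -1 ≤ ξ ∧ ξ ≤ 1 ∧ x = a * (2 * m + n + ξ) := by
    refine ⟨round ((x / a - n) / 2), 2 * ((x / a - n) / 2 - round ((x / a - n) / 2)), ?_, ?_, ?_⟩
    · linarith [(abs_le.1 (abs_sub_round ((x / a - n) / 2))).1]
    · linarith [(abs_le.1 (abs_sub_round ((x / a - n) / 2))).2]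
    · field_simp; ring
  have hR : (2 * a / √3) ^ 2 = a ^ 2 * (4 / 3) := by
    rw [div_pow, hs3]; ring
  have hdist : ∀ i j : ℤ, ((ξ - (2 * i + j)) ^ 2 + 3 * (η - j) ^ 2 ≤ 4 / 3) → ∃ m n : ℤ,
      (x - (2 * a * m + a * n)) ^ 2 + (y - a * √3 * n) ^ 2 ≤ (2 * a / √3) ^ 2 := by
    intro i j h
    refine ⟨m + i, n + j, ?_⟩
    rw [hR]
    refine le_trans (le_of_eq ?_) (mul_le_mul_of_nonneg_left h (sq_nonneg a))
    rw [hx, hy]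
    push_cast
    linear_combination a ^ 2 * (η - j) ^ 2 * hs3
  have hnear : ∀ s t : ℝ, 0 ≤ s → s ≤ 1 → 0 ≤ t → s + 3 * t ≤ 2 → s ^ 2 + 3 * t ^ 2 ≤ 4 / 3 := by
    intro s t hs hs' ht h
    nlinarith [mul_nonneg hs (sub_nonneg.2 hs'), mul_self_le_mul_self ht
      (by linarith : t ≤ (2 - s) / 3)]
  rcases le_total 0 ξ with hξ | hξ
  · rcases le_total (ξ + 3 * η) 2 with h | h
    · refine hdist 0 0 ?_
      simpa using hnear ξ η hξ hξ1 hη0 h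
    · refine hdist 0 1 ?_
      have := hnear (1 - ξ) (1 - η) (by linarith) (by linarith) (by linarith) (by linarith)
      push_cast
      linarith
  · rcases le_total (-ξ + 3 * η) 2 with h | h
    · refine hdist 0 0 ?_
      simpa using hnear (-ξ) η (by linarith) (by linarith) hη0 h
    · refine hdist (-1) 1 ?_
      have := hnear (1 + ξ) (1 - η) (by linarith) (by linarith) (by linarith) (by linarith)
      push_cast
      linarith

lemma cos_le_cos_infDist_ΔhexE {a : ℝ} (ha : 0 < a) (ha' : a < π * √3 / 4) :
    0 ≤ Real.cos (2 * a / √3) ∧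
      ∀ p, Real.cos (2 * a / √3) ≤ Real.cos (Metric.infDist p (ΔhexE a)) := by
  have h0 : 0 ≤ 2 * a / √3 := by positivity
  have h1 : 2 * a / √3 ≤ π / 2 := by
    rw [div_le_iff₀ (by positivity)]
    linarith
  have hpi := Real.pi_pos
  exact ⟨Real.cos_nonneg_of_neg_pi_div_two_le_of_le (by linarith) h1, fun p =>
    Real.cos_le_cos_of_nonneg_of_le_pi Metric.infDist_nonneg (by linarith) (infDist_ΔhexE_le ha p)⟩

lemma phi0_apply (x y z : ℝ) :
    phi0 (x, y, z) = ((x - √3 * y) / 2, (√3 * x + y) / 2, z + π / 3) := by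
  simp only [phi0, Real.cos_pi_div_three, Real.sin_pi_div_three, Prod.mk.injEq, and_true]
  constructor <;> ring

lemma phi0_iterate_five_apply (x y z : ℝ) :
    phi0^[5] (x, y, z) = ((x + √3 * y) / 2, (-(√3 * x) + y) / 2, z + 5 * π / 3) := by
  have hs3 : √3 ^ 2 = 3 := Real.sq_sqrt (by norm_num)
  have hs4 : √3 ^ 4 = 9 := by linear_combination (√3 ^ 2 + 3) * hs3
  simp only [Function.iterate_succ_apply, Function.iterate_zero_apply, phi0_apply, Prod.mk.injEq]
  refine ⟨?_, ?_, by ring⟩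
  · linear_combination (10 * (√3 * y - x) / 32) * hs3 + ((5 * x - √3 * y) / 32) * hs4
  · linear_combination (-10 * (√3 * x + y) / 32) * hs3 + ((√3 * x + 5 * y) / 32) * hs4

lemma phi0_iterate_snd_snd (n : ℕ) (p : ℝ × ℝ × ℝ) : (phi0^[n] p).2.2 = p.2.2 + n * (π / 3) := by
  induction n with
  | zero => simp
  | succ n ih =>
    rw [Function.iterate_succ_apply', phi0, ih]
    push_cast
    ring

lemma cos_add_int_mul_two_pi_eq_half {c d : ℝ} (hc : Real.cos c = 1 / 2) (k : ℤ)
    (hd : d = c + 2 * π * k) : Real.cos d = 1 / 2 := by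
  rw [hd, mul_comm (2 * π), Real.cos_add_int_mul_two_pi, hc]

lemma two_pi_div_three_le_abs {c : ℝ} (hc : 2 * π / 3 ≤ c) (hc' : c ≤ 4 * π / 3) (k : ℤ) :
    2 * π / 3 ≤ |c + 2 * π * k| := by
  have hpi := Real.pi_pos
  rcases le_or_gt 0 k with hk | hk
  · have hk' : (0 : ℝ) ≤ k := by exact_mod_cast hk
    exact le_trans (by nlinarith) (le_abs_self _)
  · have hk' : (k : ℝ) ≤ -1 := by exact_mod_cast Int.le_sub_one_of_lt hk
    exact le_trans (by nlinarith) (neg_le_abs _)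

/-- for `0 < a < π√3/4`, `Δ = Δ_hex(a)`, `Λ = (2Δ) × 2πℤ`, and any `v ∈ Λ`,
`m ∈ ℝ³`: (i) every piecewise `C¹` curve from `m` to `φ₀(m) + v` or `φ₀⁵(m) + v` has
`L_Δ`-length at least `π/3`; (ii) every piecewise `C¹` curve from `m` to `φ₀²(m) + v` or
`φ₀⁴(m) + v` has `L_Δ`-length at least `(2π/3)·cos(2a/√3)`. -/
theorem distance_to_phi_orbits_hexagonal (a : ℝ) (ha : 0 < a)
    (ha' : a < π * Real.sqrt 3 / 4)
    (v : ℝ × ℝ × ℝ) (hv : v ∈ Λhex3 a)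
    (γ₁ γ₂ γ₃ : ℝ → ℝ) (h₁ : PC1 γ₁) (h₂ : PC1 γ₂) (h₃ : PC1 γ₃) :
    (((γ₁ 1, γ₂ 1, γ₃ 1) = phi0 (γ₁ 0, γ₂ 0, γ₃ 0) + v ∨
      (γ₁ 1, γ₂ 1, γ₃ 1) = phi0^[5] (γ₁ 0, γ₂ 0, γ₃ 0) + v) →
        π / 3 ≤ sLen (ΔhexE a) γ₁ γ₂ γ₃) ∧
    (((γ₁ 1, γ₂ 1, γ₃ 1) = phi0^[2] (γ₁ 0, γ₂ 0, γ₃ 0) + v ∨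
      (γ₁ 1, γ₂ 1, γ₃ 1) = phi0^[4] (γ₁ 0, γ₂ 0, γ₃ 0) + v) →
        2 * π / 3 * Real.cos (2 * a / Real.sqrt 3) ≤ sLen (ΔhexE a) γ₁ γ₂ γ₃) := by
  have hs3 : √3 ^ 2 = 3 := Real.sq_sqrt (by norm_num)
  obtain ⟨k₁, k₂, k₃, rfl⟩ := hv
  -- the screw motion rotates the plane by `± π / 3` around a point `d` of the lattice
  have hrot : ∀ ε d₁ d₂ : ℝ, ε ^ 2 = 3 → pt2 d₁ d₂ ∈ ΔhexE a →
      γ₁ 1 - d₁ = ((γ₁ 0 - d₁) - ε * (γ₂ 0 - d₂)) / 2 →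
      γ₂ 1 - d₂ = (ε * (γ₁ 0 - d₁) + (γ₂ 0 - d₂)) / 2 →
      Real.cos (γ₃ 1 - γ₃ 0) = 1 / 2 → π / 3 ≤ sLen (ΔhexE a) γ₁ γ₂ γ₃ := by
    intro ε d₁ d₂ hε hd hx hy hz
    refine pi_div_three_le_sLen hd h₁ h₂ h₃ ?_ ?_ hz <;> rw [hx, hy]
    · linear_combination (((γ₁ 0 - d₁) ^ 2 + (γ₂ 0 - d₂) ^ 2) / 4) * hε
    · ring
  refine ⟨?_, fun h => ?_⟩
  · rintro (h | h)
    · rw [phi0_apply] at h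
      simp only [Prod.mk_add_mk, Prod.mk.injEq] at h
      obtain ⟨hx, hy, hz⟩ := h
      refine hrot √3 (2 * a * k₁ - 2 * a * k₂) (a * √3 * (2 * k₁ + 2 * k₂)) hs3
        ⟨-2 * k₂, 2 * k₁ + 2 * k₂, by push_cast; congr 1; ring⟩ ?_ ?_
        (cos_add_int_mul_two_pi_eq_half Real.cos_pi_div_three k₃ (by rw [hz]; ring))
      · rw [hx]; linear_combination (-a * (k₁ + k₂)) * hs3
      · rw [hy]; ring
    · rw [phi0_iterate_five_apply] at h
      simp only [Prod.mk_add_mk, Prod.mk.injEq] at h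
      obtain ⟨hx, hy, hz⟩ := h
      refine hrot (-√3) (2 * a * k₁ + 4 * a * k₂) (a * √3 * (-2 * k₁)) (by rw [neg_sq, hs3])
        ⟨2 * k₁ + 2 * k₂, -2 * k₁, by push_cast; congr 1; ring⟩ ?_ ?_
        (cos_add_int_mul_two_pi_eq_half (c := -(π / 3)) (by simp) (k₃ + 1)
          (by rw [hz]; push_cast; ring))
      · rw [hx]; linear_combination (-a * k₁) * hs3
      · rw [hy]; ring
  · obtain ⟨hc0, hc⟩ := cos_le_cos_infDist_ΔhexE ha ha'
    have hpi := Real.pi_pos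
    have hz : 2 * π / 3 ≤ |γ₃ 1 - γ₃ 0| := by
      rcases h with h | h
      all_goals
        have hz := congrArg (fun p => p.2.2) h
        simp only [Prod.snd_add, phi0_iterate_snd_snd] at hz
        push_cast at hz
      · rw [show γ₃ 1 - γ₃ 0 = 2 * π / 3 + 2 * π * k₃ by rw [hz]; ring]
        exact two_pi_div_three_le_abs le_rfl (by linarith) k₃
      · rw [show γ₃ 1 - γ₃ 0 = 4 * π / 3 + 2 * π * k₃ by rw [hz]; ring]
        exact two_pi_div_three_le_abs (by linarith) le_rfl k₃
    calc 2 * π / 3 * Real.cos (2 * a / √3) = Real.cos (2 * a / √3) * (2 * π / 3) := mul_comm _ _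
      _ ≤ Real.cos (2 * a / √3) * |γ₃ 1 - γ₃ 0| := mul_le_mul_of_nonneg_left hz hc0
      _ ≤ _ := mul_abs_sub_le_sLen h₁ h₂ h₃ hc0 hc

end
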